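/- If α ∉ (1/2)ℤ (i.e. 2α is not an integer multiple of 1 in K), then N(α) is a simple sl_2-module: every nonzero subspace of N(α) that is invariant under the operators E_{-1}, E_0 and E_1 equals N(α). -/

import Mathlib

noncomputable section

/-- The basis vector `v_k` of the module `N(α)`. -/
def vv (K : Type*) [Field K] (k : ℤ) : (ℤ ⊕ ℤ) →₀ K := Finsupp.single (Sum.inl k) 1

/-- The basis vector `u_k` of the module `N(α)`. -/
def uu (K : Type*) [Field K] (k : ℤ) : (ℤ ⊕ ℤ) →₀ K := Finsupp.single (Sum.inr k) 1

open Polynomial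

theorem linearMap_ext_vv_uu {K : Type*} [Field K] {f g : ((ℤ ⊕ ℤ) →₀ K) →ₗ[K] ((ℤ ⊕ ℤ) →₀ K)}
    (hv : ∀ k, f (vv K k) = g (vv K k)) (hu : ∀ k, f (uu K k) = g (uu K k)) : f = g := by
  ext1 i
  ext1
  rcases i with k | k
  · exact hv k
  · exact hu k

/-- If `p` is a nonzero polynomial with `p(T) x ∈ W` and `x ∉ W`, then `T` has an eigenvector
modulo `W`. -/
theorem exists_eigenvector_mod {K V : Type*} [Field K] [IsAlgClosed K] [AddCommGroup V]
    [Module K V] (T : Module.End K V) (W : Submodule K V) {p : K[X]} (hp : p ≠ 0) {x : V}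
    (hx : x ∉ W) (hpx : aeval T p x ∈ W) : ∃ μ : K, ∃ y ∉ W, T y - μ • y ∈ W := by
  have key : ∀ s : Multiset K, aeval T (s.map fun a => X - C a).prod x ∈ W →
      ∃ μ : K, ∃ y ∉ W, T y - μ • y ∈ W := by
    intro s
    induction s using Multiset.induction with
    | empty => intro h; simp [hx] at h
    | cons a s ih =>
      intro h
      by_cases hs : aeval T (s.map fun a => X - C a).prod x ∈ W
      · exact ih hs
      · refine ⟨a, _, hs, ?_⟩
        simpa [Module.algebraMap_end_apply] using h
  refine key p.roots ?_
  have hsplit := (IsAlgClosed.splits p).eq_prod_roots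
  rw [hsplit, map_mul, aeval_C, Module.End.mul_apply, Module.algebraMap_end_apply] at hpx
  exact (W.smul_mem_iff (leadingCoeff_ne_zero.mpr hp)).mp hpx

theorem aeval_sub_eval_smul_mem {K V : Type*} [Field K] [AddCommGroup V] [Module K V]
    {T : Module.End K V} {W : Submodule K V} (hW : ∀ x ∈ W, T x ∈ W) {μ : K} {y : V}
    (hy : T y - μ • y ∈ W) (p : K[X]) : aeval T p y - p.eval μ • y ∈ W := by
  induction p using Polynomial.induction_on' with
  | add p q hp hq =>
    simp only [map_add, LinearMap.add_apply, eval_add, add_smul]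
    convert W.add_mem hp hq using 1
    abel
  | monomial n a =>
    rw [← C_mul_X_pow_eq_monomial]
    induction n with
    | zero => simp [Module.algebraMap_end_apply]
    | succ n ih =>
      have h1 := W.add_mem (hW _ ih) (W.smul_mem (eval μ (C a * X ^ n)) hy)
      convert h1 using 1
      have h2 : (C a * X ^ (n + 1) : K[X]) = X * (C a * X ^ n) := by ring
      rw [h2, map_mul, Module.End.mul_apply, aeval_X, eval_mul, eval_X]
      simp only [map_sub, map_smul, smul_sub, smul_smul, mul_comm μ]
      abel

theorem aeval_mem_of_invariant {K V : Type*} [Field K] [AddCommGroup V] [Module K V]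
    {T : Module.End K V} {W : Submodule K V} (hW : ∀ x ∈ W, T x ∈ W) (p : K[X]) {y : V}
    (hy : y ∈ W) : aeval T p y ∈ W := by
  have h := aeval_sub_eval_smul_mem hW (μ := 0) (y := y) (by simpa using hW y hy) p
  simpa using W.add_mem h (W.smul_mem (p.eval 0) hy)

/-- The polynomial in `E_0` that sends `v_j` to `v_{j+n}`. -/
def shiftPoly (K : Type*) [Field K] (j : ℤ) (n : ℕ) : K[X] :=
  ∏ i ∈ Finset.range n, (X - C ((j : K) + i)) ^ 2

theorem shiftPoly_ne_zero (K : Type*) [Field K] (j : ℤ) (n : ℕ) : shiftPoly K j n ≠ 0 :=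
  Finset.prod_ne_zero_iff.mpr fun _ _ => pow_ne_zero _ (X_sub_C_ne_zero _)

theorem exists_of_eval_shiftPoly_eq_zero {K : Type*} [Field K] {j : ℤ} {n : ℕ} {μ : K}
    (h : (shiftPoly K j n).eval μ = 0) : ∃ z : ℤ, z < j + n ∧ μ = z := by
  rw [shiftPoly, eval_prod, Finset.prod_eq_zero_iff] at h
  obtain ⟨i, hi, h⟩ := h
  refine ⟨j + i, by simpa using hi, ?_⟩
  simpa [sub_eq_zero] using h

theorem aeval_shiftPoly_vv {K : Type*} [Field K] {T : Module.End K ((ℤ ⊕ ℤ) →₀ K)}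
    (hv : ∀ k : ℤ, T (vv K k) = (k : K) • vv K k + uu K k)
    (hu : ∀ k : ℤ, T (uu K k) = (k : K) • uu K k + vv K (k + 1)) (j : ℤ) (n : ℕ) :
    aeval T (shiftPoly K j n) (vv K j) = vv K (j + n) := by
  induction n with
  | zero => simp [shiftPoly]
  | succ n ih =>
    have h : shiftPoly K j (n + 1) = (X - C ((j : K) + n)) ^ 2 * shiftPoly K j n := by
      rw [shiftPoly, Finset.prod_range_succ, mul_comm]; rfl
    have h1 := hv (j + n)
    have h2 := hu (j + n)
    push_cast at h1 h2
    have h3 : ∀ (a : K) y, aeval T (X - C a) y = T y - a • y := fun a y => by simp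
    rw [h, map_mul, Module.End.mul_apply, ih, pow_two, map_mul, Module.End.mul_apply, h3, h3, h1,
      add_sub_cancel_left, h2, add_sub_cancel_left, Nat.cast_succ, add_assoc]

/-- Every vector lies in `K[E_0] v_j` once `j` is sufficiently negative. -/
theorem exists_forall_le_aeval_vv {K : Type*} [Field K] {T : Module.End K ((ℤ ⊕ ℤ) →₀ K)}
    (hv : ∀ k : ℤ, T (vv K k) = (k : K) • vv K k + uu K k)
    (hu : ∀ k : ℤ, T (uu K k) = (k : K) • uu K k + vv K (k + 1)) (w : (ℤ ⊕ ℤ) →₀ K) :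
    ∃ j₀ : ℤ, ∀ j ≤ j₀, ∃ p : K[X], aeval T p (vv K j) = w := by
  have hvj : ∀ k j : ℤ, j ≤ k → ∃ p : K[X], aeval T p (vv K j) = vv K k := by
    intro k j hj
    refine ⟨shiftPoly K j (k - j).toNat, ?_⟩
    rw [aeval_shiftPoly_vv hv hu]
    congr 1
    omega
  induction w using Finsupp.induction_linear with
  | zero => exact ⟨0, fun j _ => ⟨0, by simp⟩⟩
  | add x y hx hy =>
    obtain ⟨a, ha⟩ := hx
    obtain ⟨b, hb⟩ := hy
    refine ⟨min a b, fun j hj => ?_⟩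
    obtain ⟨p, hp⟩ := ha j (hj.trans (min_le_left _ _))
    obtain ⟨q, hq⟩ := hb j (hj.trans (min_le_right _ _))
    exact ⟨p + q, by rw [map_add, LinearMap.add_apply, hp, hq]⟩
  | single i c =>
    rcases i with k | k
    · refine ⟨k, fun j hj => ?_⟩
      obtain ⟨p, hp⟩ := hvj k j hj
      refine ⟨C c * p, ?_⟩
      rw [map_mul, Module.End.mul_apply, hp, aeval_C, Module.algebraMap_end_apply, vv,
        Finsupp.smul_single, smul_eq_mul, mul_one]
    · refine ⟨k, fun j hj => ?_⟩
      obtain ⟨p, hp⟩ := hvj k j hj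
      refine ⟨C c * (X - C (k : K)) * p, ?_⟩
      rw [map_mul, Module.End.mul_apply, hp, map_mul, Module.End.mul_apply, aeval_C,
        Module.algebraMap_end_apply, map_sub, aeval_X, aeval_C, LinearMap.sub_apply,
        Module.algebraMap_end_apply, hv, add_sub_cancel_left, uu, Finsupp.smul_single,
        smul_eq_mul, mul_one]

theorem eq_zero_of_forall_eval_add_mul {K : Type*} [Field K] [CharZero K] {f : K[X]} {μ c : K}
    (hc : c ≠ 0) (h : ∀ n : ℕ, f.eval (μ + c * n) = 0) : f = 0 := by
  refine eq_zero_of_infinite_isRoot f (Set.Infinite.mono ?_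
    (Set.infinite_range_of_injective (f := fun n : ℕ => μ + c * n) ?_))
  · rintro _ ⟨n, rfl⟩
    exact h n
  · intro m n hmn
    simpa [hc] using hmn

/-- If `α ∉ (1/2)ℤ`, then `N(α)` is a simple `sl₂`-module: every nonzero subspace
invariant under the operators `E_{-1}`, `E_0` and `E_1` equals `N(α)`. -/
theorem Nalpha_sl2_simple (K : Type*) [Field K] [CharZero K] [IsAlgClosed K] (α : K)
    (hα : ∀ m : ℤ, α ≠ (m : K) / 2)
    (E : ℤ → (((ℤ ⊕ ℤ) →₀ K) →ₗ[K] ((ℤ ⊕ ℤ) →₀ K)))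
    (hEv : ∀ n k : ℤ,
        E n (vv K k) = ((k : K) + α * n) • vv K (n + k) + uu K (n + k))
    (hEu : ∀ n k : ℤ,
        E n (uu K k) = ((k : K) + α * n) • uu K (n + k) + vv K (n + k + 1)) :
    ∀ W : Submodule K ((ℤ ⊕ ℤ) →₀ K),
      W ≠ ⊥ → (∀ i ∈ ({-1, 0, 1} : Set ℤ), ∀ x ∈ W, E i x ∈ W) → W = ⊤ := by
  intro W hbot hW
  by_contra htop
  have hW0 : ∀ x ∈ W, E 0 x ∈ W := hW 0 (by simp)
  have hW1 : ∀ x ∈ W, E 1 x ∈ W := hW 1 (by simp)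
  have hWm : ∀ x ∈ W, E (-1) x ∈ W := hW (-1) (by simp)
  have hv : ∀ k : ℤ, E 0 (vv K k) = (k : K) • vv K k + uu K k := by
    intro k; simpa using hEv 0 k
  have hu : ∀ k : ℤ, E 0 (uu K k) = (k : K) • uu K k + vv K (k + 1) := by
    intro k; simpa using hEu 0 k
  have comm : ∀ n x, E 0 (E n x) = E n (E 0 x) + (n : K) • E n x := by
    intro n x
    refine LinearMap.congr_fun (f := E 0 ∘ₗ E n) (g := E n ∘ₗ E 0 + (n : K) • E n)
      (linearMap_ext_vv_uu (fun k => ?_) (fun k => ?_)) x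
    all_goals
      simp only [LinearMap.comp_apply, LinearMap.add_apply, LinearMap.smul_apply, map_add,
        map_smul, hEv, hEu, zero_add, ← add_assoc]
      push_cast
      module
  have prod : ∀ ε : ℤ, ε ^ 2 = 1 → ∀ x, E (-ε) (E ε x) =
      E 0 (E 0 x) + (ε : K) • E 0 x + (α * (1 - α)) • x := by
    intro ε hε x
    have hεK : (ε : K) ^ 2 = 1 := by exact_mod_cast hε
    refine LinearMap.congr_fun (f := E (-ε) ∘ₗ E ε)
      (g := E 0 ∘ₗ E 0 + (ε : K) • E 0 + (α * (1 - α)) • LinearMap.id)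
      (linearMap_ext_vv_uu (fun k => ?_) (fun k => ?_)) x
    all_goals
      simp only [LinearMap.comp_apply, LinearMap.add_apply, LinearMap.smul_apply, map_add,
        map_smul, hEv, hEu, zero_add, ← add_assoc, LinearMap.id_apply, neg_add_cancel]
      push_cast
      match_scalars <;> first | ring1 | linear_combination (α * (1 - α)) * hεK
  -- the weights of the quotient by `W`
  set P : K → Prop := fun μ => ∃ y ∉ W, E 0 y - μ • y ∈ W
  have step : ∀ ε : ℤ, ε ^ 2 = 1 → (∀ x ∈ W, E ε x ∈ W) → (∀ x ∈ W, E (-ε) x ∈ W) →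
      ∀ μ : K, P μ → (μ + ε * α) * (μ + ε * (1 - α)) ≠ 0 → P (μ + ε) := by
    rintro ε hε hWε hWε' μ ⟨y, hy, hyμ⟩ hne
    have hεK : (ε : K) ^ 2 = 1 := by exact_mod_cast hε
    refine ⟨E ε y, fun hEy => hy ?_, ?_⟩
    · refine (W.smul_mem_iff hne).mp ?_
      have h1 := hWε' _ hEy
      rw [prod ε hε] at h1
      have h2 := W.sub_mem h1 (W.add_mem (hW0 _ hyμ) (W.smul_mem (μ + ε) hyμ))
      convert h2 using 1
      simp only [map_sub, map_smul]
      match_scalars <;> first | ring1 | linear_combination (α * (1 - α)) * hεK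
    · have h1 := hWε _ hyμ
      convert h1 using 1
      rw [comm, map_sub, map_smul]
      module
  obtain ⟨w, hwW, hw0⟩ := W.ne_bot_iff.mp hbot
  obtain ⟨J, hJ⟩ := exists_forall_le_aeval_vv hv hu w
  obtain ⟨f, hf⟩ := hJ J le_rfl
  have hf0 : f ≠ 0 := by
    rintro rfl
    exact hw0 (by simpa using hf.symm)
  have torsion : ∀ x, ∃ (j : ℤ) (n : ℕ), j + n = J ∧
      aeval (E 0) (f * shiftPoly K j n) x ∈ W := by
    intro x
    obtain ⟨j₀, hj₀⟩ := exists_forall_le_aeval_vv hv hu x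
    obtain ⟨p, hp⟩ := hj₀ (min j₀ J) (min_le_left _ _)
    have hjn : min j₀ J + ((J - min j₀ J).toNat : ℤ) = J := by omega
    refine ⟨min j₀ J, (J - min j₀ J).toNat, hjn, ?_⟩
    have h := aeval_shiftPoly_vv hv hu (min j₀ J) (J - min j₀ J).toNat
    rw [hjn] at h
    rw [← hp, ← Module.End.mul_apply, ← map_mul, mul_comm, mul_left_comm, ← mul_assoc,
      mul_comm f, mul_assoc, map_mul, Module.End.mul_apply, map_mul, Module.End.mul_apply]
    rw [h, hf]
    exact aeval_mem_of_invariant hW0 p hwW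
  have weight : ∀ μ, P μ → f.eval μ = 0 ∨ ∃ z : ℤ, z < J ∧ μ = z := by
    rintro μ ⟨y, hy, hyμ⟩
    obtain ⟨j, n, hjn, h⟩ := torsion y
    have h1 := W.sub_mem h (aeval_sub_eval_smul_mem hW0 hyμ (f * shiftPoly K j n))
    rw [sub_sub_cancel] at h1
    have h2 : eval μ (f * shiftPoly K j n) = 0 := by
      by_contra hne
      exact hy ((W.smul_mem_iff hne).mp h1)
    rw [eval_mul, mul_eq_zero] at h2
    exact h2.imp_right fun h => hjn ▸ exists_of_eval_shiftPoly_eq_zero h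
  obtain ⟨μ, hμ⟩ : ∃ μ, P μ := by
    obtain ⟨x, hx⟩ : ∃ x, x ∉ W := by
      by_contra! h
      exact htop (eq_top_iff.mpr fun x _ => h x)
    obtain ⟨j, n, -, h⟩ := torsion x
    exact exists_eigenvector_mod (E 0) W (mul_ne_zero hf0 (shiftPoly_ne_zero K j n)) hx h
  -- a chain of weights in one direction can only stop at a zero of the Casimir factor
  have chain_ends : ∀ ε : ℤ, ε ^ 2 = 1 → (∀ x ∈ W, E ε x ∈ W) → (∀ x ∈ W, E (-ε) x ∈ W) →
      ((∀ z : ℤ, μ ≠ z) ∨ ε = 1) →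
      ∃ n : ℕ, (μ + ε * n + ε * α) * (μ + ε * n + ε * (1 - α)) = 0 := by
    intro ε hε hWε hWε' hint
    by_contra! hne
    have hε0 : (ε : K) ≠ 0 := by
      rintro h
      rw [Int.cast_eq_zero] at h
      simp [h] at hε
    have all : ∀ n : ℕ, P (μ + ε * n) := by
      intro n
      induction n with
      | zero => simpa using hμ
      | succ n ih =>
        convert step ε hε hWε hWε' _ ih (hne n) using 1
        push_cast
        ring
    by_cases hz : ∃ z : ℤ, μ = z
    · obtain ⟨z, hz⟩ := hz
      have hε1 : ε = 1 := hint.resolve_left fun h => h z hz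
      subst hε1
      refine hf0 (eq_zero_of_forall_eval_add_mul (μ := μ + (J - z).toNat) hε0 fun n => ?_)
      have h := (weight _ (all ((J - z).toNat + n))).resolve_right ?_
      · convert h using 2
        push_cast
        ring
      · rintro ⟨y, hyJ, hy⟩
        rw [hz] at hy
        have : z + 1 * (((J - z).toNat + n : ℕ) : ℤ) = y := by exact_mod_cast hy
        push_cast at this
        omega
    · push Not at hz
      refine hf0 (eq_zero_of_forall_eval_add_mul (μ := μ) hε0 fun n => ?_)
      refine (weight _ (all n)).resolve_right ?_
      rintro ⟨y, -, hy⟩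
      refine hz (y - ε * n) ?_
      push_cast
      linear_combination hy
  obtain ⟨n, hn⟩ := chain_ends 1 (by norm_num) hW1 hWm (Or.inr rfl)
  have hint : ∀ z : ℤ, μ ≠ z := by
    intro z hz
    rcases mul_eq_zero.mp hn with h | h
    · refine hα (2 * (-z - n)) ?_
      push_cast at h ⊢
      linear_combination h - hz
    · refine hα (2 * (z + n + 1)) ?_
      push_cast at h ⊢
      linear_combination -h + hz
  obtain ⟨m, hm⟩ := chain_ends (-1) (by norm_num) hWm (by simpa using hW1) (Or.inl hint)
  have hnat : ((n + m + 1 : ℕ) : K) ≠ 0 := Nat.cast_ne_zero.mpr (by omega)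
  push_cast at hn hm hnat
  rcases mul_eq_zero.mp hn with h | h <;> rcases mul_eq_zero.mp hm with h' | h'
  · refine hα (-(n + m)) ?_
    push_cast
    linear_combination (h - h') / 2
  · exact hnat (by linear_combination h - h')
  · exact hnat (by linear_combination h - h')
  · refine hα (n + m + 2) ?_
    push_cast
    linear_combination (h' - h) / 2
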